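/- Let n ≥ 2 and let δ be a real number with 0 < δ < 1/2 such that ML(u₁, …, u_{n−1}) > δ for every choice of n−1 positive real speeds u₁, …, u_{n−1}. Then for any positive real speeds v₁, …, vₙ such that some ratio vᵢ/vⱼ is irrational, one has ML(v₁, …, vₙ) > δ. -/

import Mathlib

/-- `dnn x` is the distance from `x` to the nearest integer:
`dnn x = min_{m : ℤ} |x - m|`. -/
noncomputable def dnn (x : ℝ) : ℝ := ⨅ m : ℤ, |x - m|

/-- The maximum loneliness of speeds `v 0, …, v (n-1)`:
`ML v = sup_{t : ℝ} min_{i} dnn (t * v i)`. -/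
noncomputable def ML {n : ℕ} (v : Fin n → ℝ) : ℝ := ⨆ t : ℝ, ⨅ i, dnn (t * v i)

/-- The character `x ↦ exp (2 π i x)`. -/
noncomputable def ee (x : ℝ) : ℂ := Complex.exp ((2 * Real.pi * x : ℝ) * Complex.I)

lemma ee_add (x y : ℝ) : ee (x + y) = ee x * ee y := by
  unfold ee
  rw [← Complex.exp_add]; congr 1; push_cast; ring

lemma ee_zero : ee 0 = 1 := by simp [ee]

lemma norm_ee (x : ℝ) : ‖ee x‖ = 1 := Complex.norm_exp_ofReal_mul_I _

lemma ee_nat_mul (j : ℕ) (x : ℝ) : ee (j * x) = ee x ^ j := by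
  unfold ee
  rw [← Complex.exp_nat_mul]; congr 1; push_cast; ring

lemma norm_one_add_ee_sq (x : ℝ) : ‖1 + ee x‖ ^ 2 = 2 + 2 * Real.cos (2 * Real.pi * x) := by
  rw [← Complex.normSq_eq_norm_sq, Complex.normSq_apply]
  unfold ee
  simp only [Complex.add_re, Complex.add_im, Complex.one_re, Complex.one_im,
    Complex.exp_ofReal_mul_I_re, Complex.exp_ofReal_mul_I_im]
  nlinarith [Real.sin_sq_add_cos_sq (2 * Real.pi * x)]

lemma dnn_bdd (x : ℝ) : BddBelow (Set.range fun m : ℤ => |x - m|) :=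
  ⟨0, by rintro _ ⟨m, rfl⟩; exact abs_nonneg _⟩

lemma dnn_le (x : ℝ) (m : ℤ) : dnn x ≤ |x - m| := ciInf_le (dnn_bdd x) m

lemma dnn_eq (x : ℝ) : dnn x = |x - round x| :=
  le_antisymm (dnn_le x _) (le_ciInf fun m => round_le x m)

lemma dnn_nonneg (x : ℝ) : 0 ≤ dnn x := by rw [dnn_eq]; exact abs_nonneg _

lemma dnn_le_half (x : ℝ) : dnn x ≤ 1 / 2 := by rw [dnn_eq]; exact abs_sub_round x

lemma dnn_le_add (x y : ℝ) : dnn x ≤ dnn y + dnn (y - x) := by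
  have h := dnn_le x (round y - round (y - x))
  rw [dnn_eq y, dnn_eq (y - x)]
  refine h.trans ?_
  have := abs_sub (y - round y) ((y - x) - round (y - x))
  refine le_trans (le_of_eq ?_) this
  congr 1; push_cast; ring

lemma dnn_neg (x : ℝ) : dnn (-x) = dnn x := by
  have key : ∀ x, dnn (-x) ≤ dnn x := by
    intro x
    have h := dnn_le (-x) (-round x)
    rw [dnn_eq x]
    refine h.trans (le_of_eq ?_)
    rw [← abs_neg]; congr 1; push_cast; ring
  refine le_antisymm (key x) ?_
  simpa using key (-x)

lemma norm_one_add_ee_le (x ε : ℝ) (hε : 0 < ε) (h : ε ≤ dnn x) :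
    ‖1 + ee x‖ ^ 2 ≤ 2 + 2 * Real.cos (2 * Real.pi * ε) := by
  rw [norm_one_add_ee_sq]
  have h2 := dnn_le_half x
  have e : Real.cos (2 * Real.pi * x) = Real.cos (2 * Real.pi * dnn x) := by
    rw [dnn_eq]
    have : 2 * Real.pi * |x - round x| = |2 * Real.pi * (x - round x)| := by
      rw [abs_mul, abs_of_pos Real.two_pi_pos]
    rw [this, Real.cos_abs, mul_sub]
    rw [mul_comm (2 * Real.pi) (round x : ℝ), Real.cos_sub_int_mul_two_pi]
  rw [e]
  have := Real.cos_le_cos_of_nonneg_of_le_pi (x := 2 * Real.pi * ε) (y := 2 * Real.pi * dnn x)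
    (by positivity) (by nlinarith [Real.pi_pos]) (by nlinarith [Real.pi_pos])
  linarith

/-- Trigonometric sums with nonnegative coefficients twisted by an additive map `φ`, whose
mean value is at least `c`. -/
def Good (φ : ℝ →+ ℝ) (g : ℝ → ℂ) (c : ℝ) : Prop :=
  ∃ (ι : Type) (_ : Fintype ι) (a l : ι → ℝ), (∀ j, 0 ≤ a j) ∧
    (∀ s, g s = ∑ j, (a j : ℂ) * ee (s * l j - φ (l j))) ∧
    c ≤ ∑ j, if l j = 0 then a j else 0

lemma Good.one (φ : ℝ →+ ℝ) : Good φ (fun _ => 1) 1 :=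
  ⟨Unit, inferInstance, fun _ => 1, fun _ => 0, by simp, by simp [ee_zero], by simp⟩

lemma Good.mul {φ : ℝ →+ ℝ} {g h : ℝ → ℂ} {c d : ℝ} (hd0 : 0 ≤ d)
    (hg : Good φ g c) (hh : Good φ h d) : Good φ (fun s => g s * h s) (c * d) := by
  obtain ⟨ι, _, a, l, ha, hg, hc⟩ := hg
  obtain ⟨κ, _, b, m, hb, hh, hd⟩ := hh
  refine ⟨ι × κ, inferInstance, fun p => a p.1 * b p.2, fun p => l p.1 + m p.2,
    fun p => mul_nonneg (ha _) (hb _), ?_, ?_⟩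
  · intro s
    simp only [hg, hh]
    rw [Finset.sum_mul_sum, Fintype.sum_prod_type]
    refine Finset.sum_congr rfl fun i _ => Finset.sum_congr rfl fun j _ => ?_
    have : s * (l i + m j) - φ (l i + m j) = (s * l i - φ (l i)) + (s * m j - φ (m j)) := by
      rw [map_add]; ring
    rw [this, ee_add]; push_cast; ring
  · calc c * d ≤ (∑ j, if l j = 0 then a j else 0) * (∑ j, if m j = 0 then b j else 0) := by
          refine mul_le_mul hc hd hd0 (Finset.sum_nonneg fun j _ => ?_)
          split_ifs; exacts [ha _, le_rfl]
      _ ≤ _ := by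
          rw [Finset.sum_mul_sum, Fintype.sum_prod_type]
          refine Finset.sum_le_sum fun i _ => Finset.sum_le_sum fun j _ => ?_
          have := mul_nonneg (ha i) (hb j)
          by_cases h1 : l i = 0 <;> by_cases h2 : m j = 0 <;> simp [h1, h2]
          all_goals split_ifs <;> simp [this]

lemma Good.prod {φ : ℝ →+ ℝ} {ι : Type*} (S : Finset ι) (g : ι → ℝ → ℂ) (c : ℝ) (hc : 0 ≤ c)
    (h : ∀ i, Good φ (g i) c) : Good φ (fun s => ∏ i ∈ S, g i s) (c ^ S.card) := by
  classical
  induction S using Finset.induction_on with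
  | empty => simpa using Good.one φ
  | insert i S hi ih =>
    simp only [Finset.prod_insert hi, Finset.card_insert_of_notMem hi, pow_succ']
    exact Good.mul (pow_nonneg hc _) (h i) ih

lemma good_factor (φ : ℝ →+ ℝ) (v : ℝ) (N : ℕ) (hN : 0 < N) :
    Good φ (fun s => ee (-(N * (s * v - φ v))) * (1 + ee (s * v - φ v)) ^ (2 * N) / 4 ^ N)
      (1 / (2 * N)) := by
  refine ⟨Fin (2 * N + 1), inferInstance, fun j => ((2 * N).choose j : ℝ) / 4 ^ N,
    fun j => ((j : ℕ) : ℝ) * v - N * v, fun j => by positivity, ?_, ?_⟩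
  · intro s
    rw [Fin.sum_univ_eq_sum_range (fun j => ((((2 * N).choose j : ℝ) / 4 ^ N : ℝ) : ℂ) *
      ee (s * ((j : ℝ) * v - N * v) - φ ((j : ℝ) * v - N * v))) (2 * N + 1)]
    beta_reduce
    rw [add_comm (1 : ℂ), add_pow, Finset.mul_sum, Finset.sum_div]
    refine Finset.sum_congr rfl fun j _ => ?_
    have h1 : s * ((j : ℝ) * v - N * v) - φ ((j : ℝ) * v - N * v)
        = -(N * (s * v - φ v)) + j * (s * v - φ v) := by
      have : ∀ k : ℕ, φ ((k : ℝ) * v) = k * φ v := by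
        intro k
        rw [← nsmul_eq_mul, map_nsmul, nsmul_eq_mul]
      rw [map_sub, this, this]; ring
    rw [h1, ee_add, ee_nat_mul]
    push_cast
    simp only [one_pow]
    ring
  · have hle : (1 : ℝ) / (2 * N) ≤ ((2 * N).choose N : ℝ) / 4 ^ N := by
      have := Nat.four_pow_le_two_mul_self_mul_centralBinom N hN
      rw [Nat.centralBinom_eq_two_mul_choose] at this
      have h' : (4 : ℝ) ^ N ≤ 2 * N * ((2 * N).choose N : ℝ) := by exact_mod_cast this
      rw [div_le_div_iff₀ (by positivity) (by positivity)]
      linarith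
    refine hle.trans ?_
    have := Finset.single_le_sum (s := Finset.univ)
      (f := fun j : Fin (2 * N + 1) => if ((j : ℕ) : ℝ) * v - N * v = 0 then
        ((2 * N).choose j : ℝ) / 4 ^ N else 0)
      (fun j _ => by split_ifs <;> positivity)
      (Finset.mem_univ (⟨N, by omega⟩ : Fin (2 * N + 1)))
    simpa using this

open Filter Topology in
lemma mean_ee (l b : ℝ) (hl : l ≠ 0) :
    Tendsto (fun T : ℝ => (T : ℂ)⁻¹ * ∫ s in (0 : ℝ)..T, ee (s * l - b)) atTop (𝓝 0) := by
  set z : ℂ := 2 * Real.pi * l * Complex.I with hz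
  have hz0 : z ≠ 0 := by
    simp [hz, hl, Real.pi_ne_zero]
  have hint : ∀ T : ℝ, ∫ s in (0 : ℝ)..T, ee (s * l - b) = ee (-b) * ((ee (T * l) - 1) / z) := by
    intro T
    have : ∀ s : ℝ, ee (s * l - b) = ee (-b) * Complex.exp (z * s) := by
      intro s
      rw [sub_eq_neg_add, ee_add]
      congr 1
      unfold ee; congr 1; rw [hz]; push_cast; ring
    simp_rw [this]
    rw [intervalIntegral.integral_const_mul, integral_exp_mul_complex hz0]
    congr 3
    · unfold ee; congr 1; rw [hz]; push_cast; ring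
    · simp
  rw [tendsto_zero_iff_norm_tendsto_zero]
  have hlim : Tendsto (fun T : ℝ => T⁻¹ * (2 / ‖z‖)) atTop (𝓝 0) := by
    simpa using tendsto_inv_atTop_zero.mul_const (2 / ‖z‖)
  refine squeeze_zero' (Eventually.of_forall fun T => norm_nonneg _) ?_ hlim
  filter_upwards [eventually_gt_atTop (0 : ℝ)] with T hT
  rw [hint, norm_mul, norm_mul, norm_ee, one_mul, norm_div, norm_inv, Complex.norm_real,
    Real.norm_of_nonneg hT.le]
  gcongr
  calc ‖ee (T * l) - 1‖ ≤ ‖ee (T * l)‖ + ‖(1 : ℂ)‖ := norm_sub_le _ _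
    _ = 2 := by rw [norm_ee]; norm_num

lemma continuous_ee : Continuous ee := by
  unfold ee; fun_prop

open Filter Topology in
lemma Good.le {φ : ℝ →+ ℝ} {g : ℝ → ℂ} {c B : ℝ} (hg : Good φ g c) (hB : ∀ s, ‖g s‖ ≤ B) :
    c ≤ B := by
  obtain ⟨ι, _, a, l, ha, hg, hc⟩ := hg
  refine hc.trans ?_
  have hcont : ∀ j, Continuous fun s : ℝ => (a j : ℂ) * ee (s * l j - φ (l j)) := by
    intro j
    exact continuous_const.mul (continuous_ee.comp (by fun_prop))
  have hmean : Tendsto (fun T : ℝ => (T : ℂ)⁻¹ * ∫ s in (0 : ℝ)..T, g s) atTop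
      (𝓝 (∑ j, if l j = 0 then (a j : ℂ) else 0)) := by
    have : ∀ T : ℝ, (T : ℂ)⁻¹ * ∫ s in (0 : ℝ)..T, g s =
        ∑ j, (a j : ℂ) * ((T : ℂ)⁻¹ * ∫ s in (0 : ℝ)..T, ee (s * l j - φ (l j))) := by
      intro T
      simp_rw [hg]
      rw [intervalIntegral.integral_finsetSum fun j _ => (hcont j).intervalIntegrable _ _,
        Finset.mul_sum]
      refine Finset.sum_congr rfl fun j _ => ?_
      rw [intervalIntegral.integral_const_mul]; ring
    simp_rw [this]
    refine tendsto_finsetSum _ fun j _ => ?_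
    by_cases h : l j = 0
    · simp only [h, if_true, mul_zero, map_zero, sub_zero, ee_zero]
      refine tendsto_const_nhds.congr' ?_
      filter_upwards [eventually_gt_atTop (0 : ℝ)] with T hT
      have : (T : ℂ) ≠ 0 := by exact_mod_cast hT.ne'
      simp [this]
    · simp only [h, if_false]
      simpa using (mean_ee (l j) (φ (l j)) h).const_mul (a j : ℂ)
  have hn := hmean.norm
  have hle : ‖∑ j, if l j = 0 then (a j : ℂ) else 0‖ ≤ B := by
    refine le_of_tendsto hn ?_
    filter_upwards [eventually_gt_atTop (0 : ℝ)] with T hT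
    have := intervalIntegral.norm_integral_le_of_norm_le_const (a := 0) (b := T) (f := g) (C := B)
      fun s _ => hB s
    rw [norm_mul, norm_inv, Complex.norm_real, Real.norm_of_nonneg hT.le, inv_mul_le_iff₀ hT]
    rw [sub_zero, abs_of_pos hT] at this
    linarith
  refine le_trans ?_ hle
  have : (∑ j, if l j = 0 then (a j : ℂ) else 0) = ((∑ j, if l j = 0 then a j else 0 : ℝ) : ℂ) := by
    push_cast
    refine Finset.sum_congr rfl fun j _ => ?_
    split_ifs <;> simp
  rw [this, Complex.norm_real]
  exact le_abs_self _

open Filter Topology in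
lemma kronecker {n : ℕ} (v : Fin n → ℝ) (φ : ℝ →+ ℝ) (ε : ℝ) (hε : 0 < ε) :
    ∃ s : ℝ, ∀ k, dnn (s * v k - φ (v k)) < ε := by
  by_contra! hcon
  have hε2 : ε ≤ 1 / 2 := by
    obtain ⟨k, hk⟩ := hcon 0
    exact hk.trans (dnn_le_half _)
  set ρ : ℝ := (1 + Real.cos (2 * Real.pi * ε)) / 2 with hρ
  have hρ0 : 0 ≤ ρ := by
    have := Real.neg_one_le_cos (2 * Real.pi * ε)
    rw [hρ]; linarith
  have hρ1 : ρ < 1 := by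
    have := Real.cos_lt_cos_of_nonneg_of_le_pi (x := 0) (y := 2 * Real.pi * ε) le_rfl
      (by nlinarith [Real.pi_pos]) (by positivity)
    rw [Real.cos_zero] at this
    rw [hρ]; linarith
  have main : ∀ N : ℕ, 0 < N → (1 / (2 * N : ℝ)) ^ n ≤ ρ ^ N := by
    intro N hN
    have hG := Good.prod (φ := φ) (Finset.univ : Finset (Fin n)) _ (1 / (2 * N : ℝ))
      (by positivity) (fun k => good_factor φ (v k) N hN)
    rw [Finset.card_univ, Fintype.card_fin] at hG
    refine hG.le fun s => ?_
    rw [norm_prod]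
    have hnorm : ∀ k, ‖ee (-(N * (s * v k - φ (v k)))) *
        (1 + ee (s * v k - φ (v k))) ^ (2 * N) / 4 ^ N‖
        = (‖1 + ee (s * v k - φ (v k))‖ ^ 2 / 4) ^ N := by
      intro k
      rw [norm_div, norm_mul, norm_ee, one_mul, norm_pow, pow_mul, div_pow]
      simp
    simp_rw [hnorm]
    obtain ⟨k, hk⟩ := hcon s
    rw [← Finset.mul_prod_erase _ _ (Finset.mem_univ k)]
    have h1 : (‖1 + ee (s * v k - φ (v k))‖ ^ 2 / 4) ^ N ≤ ρ ^ N := by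
      gcongr
      have := norm_one_add_ee_le _ ε hε hk
      rw [hρ]; linarith
    have h2 : ∏ x ∈ Finset.univ.erase k, (‖1 + ee (s * v x - φ (v x))‖ ^ 2 / 4) ^ N ≤ 1 := by
      refine Finset.prod_le_one (fun x _ => by positivity) fun x _ => ?_
      refine pow_le_one₀ (by positivity) ?_
      rw [norm_one_add_ee_sq]
      have := Real.cos_le_one (2 * Real.pi * (s * v x - φ (v x)))
      linarith
    calc _ ≤ ρ ^ N * 1 := mul_le_mul h1 h2 (by positivity) (by positivity)
      _ = ρ ^ N := mul_one _
  have hlim : Tendsto (fun N : ℕ => (2 : ℝ) ^ n * ((N : ℝ) ^ n * ρ ^ N)) atTop (𝓝 0) := by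
    simpa using (tendsto_pow_const_mul_const_pow_of_lt_one n hρ0 hρ1).const_mul ((2 : ℝ) ^ n)
  obtain ⟨N, hN, hN0⟩ := ((hlim.eventually (gt_mem_nhds one_pos)).and
    (eventually_gt_atTop 0)).exists
  have hm := main N hN0
  have hNp : (0 : ℝ) < N := by exact_mod_cast hN0
  rw [div_pow, one_pow, div_le_iff₀ (by positivity), mul_pow] at hm
  linarith

lemma ML_bdd {n : ℕ} (hn : 0 < n) (v : Fin n → ℝ) :
    BddAbove (Set.range fun t : ℝ => ⨅ i, dnn (t * v i)) := by
  refine ⟨1 / 2, ?_⟩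
  rintro _ ⟨t, rfl⟩
  exact (ciInf_le (Set.finite_range _).bddBelow ⟨0, hn⟩).trans (dnn_le_half _)

lemma exists_functional {n : ℕ} (v : Fin n → ℝ) (hv : ∀ i, 0 < v i)
    (hirr : ∃ i j : Fin n, Irrational (v i / v j)) :
    ∃ φ : ℝ →+ ℝ, (∀ k, φ (v k) ≠ 0) ∧ ∃ i j, i ≠ j ∧ φ (v i) = -φ (v j) := by
  obtain ⟨i₀, j₀, h⟩ := hirr
  have hnot : v i₀ ∉ Submodule.span ℚ {v j₀} := by
    rw [Submodule.mem_span_singleton]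
    rintro ⟨q, hq⟩
    apply h
    refine ⟨q, ?_⟩
    rw [← hq, Rat.smul_def, mul_div_assoc, div_self (hv j₀).ne', mul_one]
  obtain ⟨ψ, hψ, hker⟩ := Submodule.exists_le_ker_of_notMem hnot
  have hψj : ψ (v j₀) = 0 := hker (Submodule.mem_span_singleton_self _)
  set r : Fin n → ℝ := fun k => (ψ (v k) : ℝ) / v k with hr
  have hrne : r i₀ ≠ r j₀ := by
    simp only [hr, hψj]
    simp [hψ, (hv i₀).ne']
  obtain ⟨i, -, hi⟩ := Finset.exists_min_image Finset.univ r ⟨i₀, Finset.mem_univ _⟩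
  have hne : (Finset.univ.filter fun k => r k ≠ r i).Nonempty := by
    by_cases h1 : r i₀ = r i
    · exact ⟨j₀, by simpa [← h1] using hrne.symm⟩
    · exact ⟨i₀, by simpa using h1⟩
  obtain ⟨j, hj, hjmin⟩ := Finset.exists_min_image _ r hne
  have hj' : r j ≠ r i := by simpa using hj
  have hlt : r i < r j := lt_of_le_of_ne (hi j (Finset.mem_univ _)) hj'.symm
  set c : ℝ := ((ψ (v i) : ℝ) + ψ (v j)) / (v i + v j) with hc
  have hvi := hv i
  have hvj := hv j
  have hψr : ∀ k, (ψ (v k) : ℝ) = r k * v k := fun k => by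
    simp only [hr]; rw [div_mul_cancel₀ _ (hv k).ne']
  have hcm : c * (v i + v j) = (ψ (v i) : ℝ) + ψ (v j) := by
    rw [hc, div_mul_cancel₀ _ (by positivity)]
  have hc1 : r i < c := by
    rw [hc, lt_div_iff₀ (by positivity), hψr, hψr]; nlinarith
  have hc2 : c < r j := by
    rw [hc, div_lt_iff₀ (by positivity), hψr, hψr]; nlinarith
  refine ⟨⟨⟨fun x => (ψ x : ℝ) - c * x, by simp⟩, fun x y => ?_⟩, fun k => ?_, i, j, ?_, ?_⟩
  · simp only [map_add]; push_cast; ring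
  · change (ψ (v k) : ℝ) - c * v k ≠ 0
    rw [hψr, ← sub_mul]
    refine mul_ne_zero ?_ (hv k).ne'
    by_cases hk : r k = r i
    · rw [hk]; linarith
    · have := hjmin k (by simpa using hk)
      linarith
  · rintro rfl; exact hj' rfl
  · change (ψ (v i) : ℝ) - c * v i = -((ψ (v j) : ℝ) - c * v j)
    linarith

theorem stmt_15 (n : ℕ) (hn : 2 ≤ n) (δ : ℝ) (hδ₀ : 0 < δ) (hδ₁ : δ < 1 / 2)
    (hδ : ∀ u : Fin (n - 1) → ℝ, (∀ i, 0 < u i) → ML u > δ)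
    (v : Fin n → ℝ) (hv : ∀ i, 0 < v i)
    (hirr : ∃ i j : Fin n, Irrational (v i / v j)) :
    ML v > δ := by
  obtain ⟨φ, hφ, i, j, hij, hφij⟩ := exists_functional v hv hirr
  obtain ⟨m, rfl⟩ : ∃ m, n = m + 1 := ⟨n - 1, by omega⟩
  have hm : 0 < m := by omega
  have h1 : ML (fun k : Fin m => |φ (v (j.succAbove k))|) > δ :=
    hδ _ fun k => abs_pos.mpr (hφ _)
  obtain ⟨t, ht⟩ := exists_lt_of_lt_ciSup h1
  set μ : ℝ := ⨅ k : Fin m, dnn (t * |φ (v (j.succAbove k))|) with hμ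
  have habs : ∀ x, dnn (t * |x|) = dnn (t * x) := by
    intro x
    rcases abs_choice x with h | h <;> rw [h]
    rw [mul_neg, dnn_neg]
  have hle : ∀ k : Fin (m + 1), μ ≤ dnn (t * φ (v k)) := by
    have hne : ∀ k, k ≠ j → μ ≤ dnn (t * φ (v k)) := by
      intro k hk
      obtain ⟨k', rfl⟩ := Fin.exists_succAbove_eq hk
      rw [← habs]
      exact ciInf_le (Set.finite_range _).bddBelow k'
    intro k
    by_cases hk : k = j
    · subst hk
      have := hne i hij
      rwa [hφij, mul_neg, dnn_neg] at this
    · exact hne k hk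
  obtain ⟨s, hs⟩ := kronecker v ((AddMonoidHom.mulLeft t).comp φ) ((μ - δ) / 2) (by linarith)
  have h2 : (μ + δ) / 2 ≤ ⨅ k, dnn (s * v k) := by
    refine le_ciInf fun k => ?_
    have h3 := dnn_le_add (t * φ (v k)) (s * v k)
    have h4 : dnn (s * v k - t * φ (v k)) < (μ - δ) / 2 := hs k
    have := hle k
    linarith
  have h3 : (⨅ k, dnn (s * v k)) ≤ ML v := le_ciSup (ML_bdd (by omega) v) s
  change δ < ML v
  linarith
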